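/- Let φ be an infinitary propositional formula in negation normal form whose set of subformulas φ↓ is countable. If the poset H(φ) is nonempty (equivalently, if Player II has a winning strategy in the model-existence game G({φ})), then φ has a model: there exists a filter g on H(φ) meeting all the dense sets D_ψ (for disjunctions ψ ∈ φ↓) and D_{ψ,i} (for conjunctions ψ ∈ φ↓ and conjunct indices i), and the associated valuation μ_g, defined by μ_g(p) = true iff the atom p belongs to ⋃g, satisfies φ. -/

import Mathlib

universe u

/-- Infinitary propositional formulas in negation normal form over letters `L`. -/
inductive NNF (L : Type u) : Type (u + 1)
  | pos (p : L) : NNF L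
  | neg (p : L) : NNF L
  | conj (I : Type u) (f : I → NNF L) : NNF L
  | disj (I : Type u) (f : I → NNF L) : NNF L

/-- Satisfaction of a formula by a valuation `μ : L → Bool`. -/
def NNF.Sat {L : Type u} (μ : L → Bool) : NNF L → Prop
  | .pos p => μ p = true
  | .neg p => μ p = false
  | .conj _ f => ∀ i, NNF.Sat μ (f i)
  | .disj _ f => ∃ i, NNF.Sat μ (f i)

/-- The subformula closure of a set of formulas: the smallest superset closed under
passing from a conjunction or disjunction to each immediate subformula. -/
inductive SubCl {L : Type u} (w : Set (NNF L)) : NNF L → Prop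
  | base {φ : NNF L} : φ ∈ w → SubCl w φ
  | conj {I : Type u} {f : I → NNF L} (i : I) : SubCl w (NNF.conj I f) → SubCl w (f i)
  | disj {I : Type u} {f : I → NNF L} (i : I) : SubCl w (NNF.disj I f) → SubCl w (f i)

/-- A challenge (move of Player I) in the model-existence game:  a disjunction,
a conjunction together with a conjunct index, or a dummy move. -/
inductive Challenge (L : Type u) : Type (u + 1)
  | pass : Challenge L
  | disj (I : Type u) (f : I → NNF L) : Challenge L
  | conj (I : Type u) (f : I → NNF L) (i : I) : Challenge L

/-- `Answers prev Q next` expresses that `next` is a legal answer of Player II to the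
challenge `Q` of Player I, when the previously accumulated set of formulas is `prev`. -/
def Answers {L : Type u} (prev : Set (NNF L)) (Q : Challenge L) (next : Set (NNF L)) : Prop :=
  prev ⊆ next ∧
  match Q with
  | .pass => True
  | .disj I f => NNF.disj I f ∈ prev → ∃ i, f i ∈ next
  | .conj I f i => NNF.conj I f ∈ prev → f i ∈ next

/-- A strategy for Player II: given the challenges played by Player I so far
(in rounds `0,…,n`), produce the answer `w_n`. -/
def IIStrat (L : Type u) := List (Challenge L) → Set (NNF L)

/-- The answer `w_n` of Player II following strategy `σ` against the play `f` of Player I. -/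
def playII {L : Type u} (σ : IIStrat L) (f : ℕ → Challenge L) (n : ℕ) : Set (NNF L) :=
  σ (List.ofFn fun i : Fin (n + 1) => f i)

/-- The set `w_{n-1}` (with `w_{-1} = w`) preceding round `n`. -/
def prevII {L : Type u} (w : Set (NNF L)) (σ : IIStrat L) (f : ℕ → Challenge L) :
    ℕ → Set (NNF L)
  | 0 => w
  | n + 1 => playII σ f n

/-- A set of formulas contains no atom together with its negation. -/
def ConsistentSet {L : Type u} (s : Set (NNF L)) : Prop :=
  ∀ p : L, ¬ (NNF.pos p ∈ s ∧ NNF.neg p ∈ s)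

/-- Player II has a winning strategy in the model-existence game `G(w)`. -/
def WinII {L : Type u} (w : Set (NNF L)) : Prop :=
  ∃ σ : IIStrat L, ∀ f : ℕ → Challenge L,
    (∀ n : ℕ, Answers (prevII w σ f n) (f n) (playII σ f n)) ∧
    ConsistentSet (⋃ n : ℕ, playII σ f n)

/-- A strategy for Player I: given the answers of Player II in the previous rounds,
produce the next challenge. -/
def IStrat (L : Type u) := List (Set (NNF L)) → Challenge L

/-- The challenge played by Player I in round `n` following strategy `τ` against
the answers `g` of Player II. -/
def movesI {L : Type u} (τ : IStrat L) (g : ℕ → Set (NNF L)) (n : ℕ) : Challenge L :=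
  τ (List.ofFn fun i : Fin n => g i)

/-- The set `w_{n-1}` (with `w_{-1} = w`) preceding round `n`, given the answers `g`. -/
def prevSet {L : Type u} (w : Set (NNF L)) (g : ℕ → Set (NNF L)) : ℕ → Set (NNF L)
  | 0 => w
  | n + 1 => g n

/-- Player I has a winning strategy in the model-existence game `G(w)`. -/
def WinI {L : Type u} (w : Set (NNF L)) : Prop :=
  ∃ τ : IStrat L, ∀ g : ℕ → Set (NNF L),
    (∀ n : ℕ, Answers (prevSet w g n) (movesI τ g n) (g n)) →
    ¬ ConsistentSet (⋃ n : ℕ, g n)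

/-- The subformulas of a single formula `φ`. -/
def Subformulas {L : Type u} (φ : NNF L) : Set (NNF L) := {ψ | SubCl {φ} ψ}

/-- A condition in the poset `H(φ)`: a finite set `w` with `φ ∈ w ⊆ φ↓` such that
Player II wins `G(w)`. -/
def HCond {L : Type u} (φ : NNF L) (w : Set (NNF L)) : Prop :=
  φ ∈ w ∧ w ⊆ Subformulas φ ∧ w.Finite ∧ WinII w

/-- A filter on the poset `H(φ)` (ordered by reverse inclusion): a nonempty,
downward directed (i.e. directed towards stronger common extensions), upward closed
set of conditions. -/
def HFilter {L : Type u} (φ : NNF L) (g : Set (Set (NNF L))) : Prop :=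
  g.Nonempty ∧ (∀ w ∈ g, HCond φ w) ∧
  (∀ w ∈ g, ∀ z ∈ g, ∃ v ∈ g, w ⊆ v ∧ z ⊆ v) ∧
  (∀ w ∈ g, ∀ z, HCond φ z → z ⊆ w → z ∈ g)

theorem answers_mono {L : Type u} {a b c : Set (NNF L)} {Q : Challenge L}
    (hab : a ⊆ b) (h : Answers b Q c) : Answers a Q c := by
  cases Q with
  | pass => exact ⟨hab.trans h.1, trivial⟩
  | disj I f => exact ⟨hab.trans h.1, fun hm => h.2 (hab hm)⟩
  | conj I f i => exact ⟨hab.trans h.1, fun hm => h.2 (hab hm)⟩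

/-- The play starting with `Q` and continuing with `f`. -/
def consPlay {L : Type u} (Q : Challenge L) (f : ℕ → Challenge L) : ℕ → Challenge L
  | 0 => Q
  | n + 1 => f n

theorem playII_cons {L : Type u} (σ : IIStrat L) (Q : Challenge L) (f : ℕ → Challenge L) (n : ℕ) :
    playII (fun l => σ (Q :: l)) f n = playII σ (consPlay Q f) (n + 1) := by
  unfold playII
  conv_rhs => rw [List.ofFn_succ]
  rfl

/-- After any challenge, Player II has an answer all of whose subsets are winning. -/
theorem winII_step {L : Type u} {w : Set (NNF L)} (h : WinII w) (Q : Challenge L) :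
    ∃ v, Answers w Q v ∧ ∀ w' ⊆ v, WinII w' := by
  obtain ⟨σ, hσ⟩ := h
  refine ⟨σ [Q], ?_, ?_⟩
  · have := (hσ (consPlay Q fun _ => Q)).1 0
    simpa [prevII, playII, consPlay] using this
  · intro w' hw'
    refine ⟨fun l => σ (Q :: l), fun f => ⟨?_, ?_⟩⟩
    · intro n
      have h1 := (hσ (consPlay Q f)).1 (n + 1)
      rw [playII_cons]
      refine answers_mono ?_ h1
      cases n with
      | zero => simpa [prevII, playII, consPlay] using hw'
      | succ n =>
        show playII (fun l => σ (Q :: l)) f n ⊆ playII σ (consPlay Q f) (n + 1)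
        rw [playII_cons]
    · intro p hp
      refine (hσ (consPlay Q f)).2 p ?_
      simp only [Set.mem_iUnion, playII_cons] at hp ⊢
      exact ⟨hp.1.imp' (· + 1) fun _ h => h, hp.2.imp' (· + 1) fun _ h => h⟩

theorem winII_consistent {L : Type u} {w : Set (NNF L)} (h : WinII w) : ConsistentSet w := by
  obtain ⟨σ, hσ⟩ := h
  have h1 := hσ fun _ => Challenge.pass
  intro p hp
  have h0 := (h1.1 0).1
  exact h1.2 p ⟨Set.mem_iUnion.2 ⟨0, h0 hp.1⟩, Set.mem_iUnion.2 ⟨0, h0 hp.2⟩⟩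

theorem hcond_insert {L : Type u} {φ χ : NNF L} {w : Set (NNF L)} (h : HCond φ w)
    (hχ : χ ∈ Subformulas φ) (hw : WinII (insert χ w)) : HCond φ (insert χ w) :=
  ⟨Or.inr h.1, Set.insert_subset hχ h.2.1, h.2.2.1.insert _, hw⟩

theorem hcond_step {L : Type u} {φ : NNF L} {w : Set (NNF L)} (h : HCond φ w) (ψ χ : NNF L) :
    ∃ w', HCond φ w' ∧ w ⊆ w' ∧
      (∀ (I : Type u) (f : I → NNF L), ψ = NNF.disj I f → ψ ∈ w → ∃ i, f i ∈ w') ∧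
      (∀ (I : Type u) (f : I → NNF L) (i : I), ψ = NNF.conj I f → χ = f i → ψ ∈ w → f i ∈ w') := by
  by_cases hψ : ψ ∈ w
  swap
  · exact ⟨w, h, subset_rfl, fun _ _ _ h' => (hψ h').elim, fun _ _ _ _ _ h' => (hψ h').elim⟩
  cases ψ with
  | pos p => exact ⟨w, h, subset_rfl, fun _ _ h' => by simp at h', fun _ _ _ h' => by simp at h'⟩
  | neg p => exact ⟨w, h, subset_rfl, fun _ _ h' => by simp at h', fun _ _ _ h' => by simp at h'⟩
  | conj I f =>
    by_cases hc : ∃ i, χ = f i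
    · obtain ⟨i, rfl⟩ := hc
      obtain ⟨v, hv, hsub⟩ := winII_step h.2.2.2 (Challenge.conj I f i)
      refine ⟨insert (f i) w, hcond_insert h (SubCl.conj i (h.2.1 hψ))
        (hsub _ (Set.insert_subset (hv.2 hψ) hv.1)), Set.subset_insert _ _,
        fun _ _ h' => by simp at h', ?_⟩
      intro J k j _ h2 _
      exact Or.inl h2.symm
    · refine ⟨w, h, subset_rfl, fun _ _ h' => by simp at h', ?_⟩
      intro J k j h1 h2 _
      cases h1
      exact (hc ⟨j, h2⟩).elim
  | disj I f =>
    obtain ⟨v, hv, hsub⟩ := winII_step h.2.2.2 (Challenge.disj I f)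
    obtain ⟨i, hi⟩ := hv.2 hψ
    refine ⟨insert (f i) w, hcond_insert h (SubCl.disj i (h.2.1 hψ))
        (hsub _ (Set.insert_subset hi hv.1)), Set.subset_insert _ _, ?_,
        fun _ _ _ h' => by simp at h'⟩
    intro J k h1 _
    cases h1
    exact ⟨i, Or.inl rfl⟩

/-- if `φ↓` is countable and the poset `H(φ)` is nonempty, then there is a
filter `g` on `H(φ)` meeting all the dense sets `D_ψ` and `D_{ψ,i}`, and the associated
valuation `μ_g` (true exactly on the atoms in `⋃ g`) satisfies `φ`. -/
theorem stmt9 {L : Type u} (φ : NNF L)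
    (hcount : (Subformulas φ).Countable)
    (hne : ∃ w : Set (NNF L), HCond φ w) :
    ∃ g : Set (Set (NNF L)), HFilter φ g ∧
      (∀ (I : Type u) (f : I → NNF L), NNF.disj I f ∈ Subformulas φ →
        ∃ w ∈ g, NNF.disj I f ∉ w ∨ ∃ i : I, f i ∈ w) ∧
      (∀ (I : Type u) (f : I → NNF L) (i : I), NNF.conj I f ∈ Subformulas φ →
        ∃ w ∈ g, NNF.conj I f ∉ w ∨ f i ∈ w) ∧
      ∀ μ : L → Bool, (∀ p : L, μ p = true ↔ NNF.pos p ∈ ⋃₀ g) → NNF.Sat μ φ := by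
  obtain ⟨w₀, hw₀⟩ := hne
  obtain ⟨e, he⟩ := hcount.exists_eq_range ⟨φ, SubCl.base rfl⟩
  choose nxt hnx hsub hdis hcon using
    fun (w : {w : Set (NNF L) // HCond φ w}) (ψ χ : NNF L) => hcond_step w.2 ψ χ
  let s : ℕ → {w : Set (NNF L) // HCond φ w} := fun n => Nat.rec ⟨w₀, hw₀⟩
    (fun n w => ⟨nxt w (e n.unpair.1) (e n.unpair.2.unpair.1), hnx _ _ _⟩) n
  have hs : ∀ n, (s (n + 1)).1 = nxt (s n) (e n.unpair.1) (e n.unpair.2.unpair.1) := fun _ => rfl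
  have hmono : Monotone fun n => (s n).1 :=
    monotone_nat_of_le_succ fun n => by
      show (s n).1 ⊆ (s (n + 1)).1
      rw [hs]; exact hsub _ _ _
  have hstage : ∀ a b m : ℕ, ∃ n, m ≤ n ∧ (s (n + 1)).1 = nxt (s n) (e a) (e b) := by
    intro a b m
    refine ⟨Nat.pair a (Nat.pair b m),
      (Nat.right_le_pair b m).trans (Nat.right_le_pair a _), ?_⟩
    rw [hs]; simp
  have hD : ∀ (I : Type u) (f : I → NNF L) (m : ℕ), NNF.disj I f ∈ (s m).1 →
      ∃ n i, f i ∈ (s n).1 := by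
    intro I f m hm
    obtain ⟨a, ha⟩ : NNF.disj I f ∈ Set.range e := he ▸ (s m).2.2.1 hm
    obtain ⟨n, hn, hn'⟩ := hstage a a m
    obtain ⟨i, hi⟩ := hdis (s n) (e a) (e a) I f ha (ha ▸ hmono hn hm)
    exact ⟨n + 1, i, hn' ▸ hi⟩
  have hC : ∀ (I : Type u) (f : I → NNF L) (i : I) (m : ℕ), NNF.conj I f ∈ (s m).1 →
      ∃ n, f i ∈ (s n).1 := by
    intro I f i m hm
    have hm' := (s m).2.2.1 hm
    obtain ⟨a, ha⟩ : NNF.conj I f ∈ Set.range e := he ▸ hm'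
    obtain ⟨b, hb⟩ : f i ∈ Set.range e := he ▸ SubCl.conj i hm'
    obtain ⟨n, hn, hn'⟩ := hstage a b m
    have hi := hcon (s n) (e a) (e b) I f i ha hb (ha ▸ hmono hn hm)
    exact ⟨n + 1, hn' ▸ hi⟩
  have hg : ∀ n, (s n).1 ∈ {z | HCond φ z ∧ ∃ n, z ⊆ (s n).1} :=
    fun n => ⟨(s n).2, n, subset_rfl⟩
  refine ⟨{z | HCond φ z ∧ ∃ n, z ⊆ (s n).1}, ⟨⟨_, hg 0⟩, fun w hw => hw.1, ?_, ?_⟩, ?_, ?_, ?_⟩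
  · rintro w ⟨-, n, hn⟩ z ⟨-, m, hm⟩
    exact ⟨_, hg (max n m), hn.trans (hmono (le_max_left n m)), hm.trans (hmono (le_max_right n m))⟩
  · rintro w ⟨-, n, hn⟩ z hz hzw
    exact ⟨hz, n, hzw.trans hn⟩
  · intro I f _
    by_cases h : NNF.disj I f ∈ (s 0).1
    · obtain ⟨n, i, hi⟩ := hD I f 0 h
      exact ⟨_, hg n, Or.inr ⟨i, hi⟩⟩
    · exact ⟨_, hg 0, Or.inl h⟩
  · intro I f i _
    by_cases h : NNF.conj I f ∈ (s 0).1
    · obtain ⟨n, hi⟩ := hC I f i 0 h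
      exact ⟨_, hg n, Or.inr hi⟩
    · exact ⟨_, hg 0, Or.inl h⟩
  · intro μ hμ
    have key : ∀ ψ : NNF L, ∀ n, ψ ∈ (s n).1 → NNF.Sat μ ψ := by
      intro ψ
      induction ψ with
      | pos p => exact fun n hn => (hμ p).2 ⟨_, hg n, hn⟩
      | neg p =>
        intro n hn
        show μ p = false
        by_contra hp
        obtain ⟨z, ⟨-, m, hm⟩, hz⟩ := (hμ p).1 (by simpa using hp)
        exact winII_consistent (s (max m n)).2.2.2.2 p
          ⟨hmono (le_max_left m n) (hm hz), hmono (le_max_right m n) hn⟩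
      | conj I f ih =>
        intro n hn i
        obtain ⟨m, hm⟩ := hC I f i n hn
        exact ih i m hm
      | disj I f ih =>
        intro n hn
        obtain ⟨m, i, hm⟩ := hD I f n hn
        exact ⟨i, ih i m hm⟩
    exact key φ 0 (s 0).2.1
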